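/- Let n ≥ 2, 0 ≤ r < 1, b_r(z) = (r-z)/(1-rz), and e_n(z) = (1-r²)^{1/2}/(1-rz) · b_r(z)^{n-1}. Then ‖e_n'‖₂ = (1/(1-r²))·‖φ_n‖₂, where φ_n(z) = (1+rz)·(nrz + (n-1)) and ‖φ_n‖₂² = (n-1)² + (2n-1)²r² + n²r⁴. -/

import Mathlib

open Complex Filter Finset MeasureTheory Metric

noncomputable section

/-- The `k`-th Taylor coefficient of `f` at `0`. -/
def hcoeff (f : ℂ → ℂ) (k : ℕ) : ℂ := iteratedDeriv k f 0 / (Nat.factorial k : ℂ)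

/-- The Hardy space `H²` norm of `f`, computed through the Taylor coefficients at `0`:
`‖f‖₂² = ∑_{k≥0} |f̂(k)|²`. -/
def h2norm (f : ℂ → ℂ) : ℝ := Real.sqrt (∑' k : ℕ, ‖hcoeff f k‖ ^ 2)

/-- Membership in the Hardy space `H²` of the unit disc: `f` is holomorphic on the unit
disc and its Taylor coefficients are square-summable. -/
def MemH2 (f : ℂ → ℂ) : Prop :=
  DifferentiableOn ℂ f (ball 0 1) ∧ Summable (fun k : ℕ => ‖hcoeff f k‖ ^ 2)

/-- The `H²` inner product `(f,g) = ∑_{k≥0} f̂(k)·conj(ĝ(k))`. -/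
def h2inner (f g : ℂ → ℂ) : ℂ := ∑' k : ℕ, hcoeff f k * (starRingEnd ℂ) (hcoeff g k)

/-- Elementary Blaschke factor `b_λ(z) = (λ - z)/(1 - conj(λ)·z)`. -/
def blaschke (l : ℂ) : ℂ → ℂ := fun z => (l - z) / (1 - (starRingEnd ℂ) l * z)

/-- Membership in the model space `K_B = H² ⊖ B·H²`: `f ∈ H²` and `f` is orthogonal to
`B·g` for every `g ∈ H²`. -/
def MemKB (B f : ℂ → ℂ) : Prop :=
  MemH2 f ∧ ∀ g : ℂ → ℂ, MemH2 g → h2inner f (fun z => B z * g z) = 0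

/-- The norm of the differentiation operator `D : K_B → H²`, `Df = f'`. -/
def DNorm (B : ℂ → ℂ) : ℝ :=
  sSup {x : ℝ | ∃ f : ℂ → ℂ, MemKB B f ∧ h2norm f ≤ 1 ∧ x = h2norm (deriv f)}

/-- `C_{n,r}`: the supremum of `‖D‖_{K_{B_σ} → H²}` over all finite sequences `σ` in the
unit disc with `1 ≤ card σ ≤ n` and `|λ| ≤ r` for all `λ ∈ σ`. -/
def Cnr (n : ℕ) (r : ℝ) : ℝ :=
  sSup {x : ℝ | ∃ m : ℕ, 1 ≤ m ∧ m ≤ n ∧ ∃ l : Fin m → ℂ,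
    (∀ j, ‖l j‖ ≤ r) ∧ x = DNorm (fun z => ∏ j, blaschke (l j) z)}

/-- The Malmquist–Walsh basis function `e_k(z) = (1-r²)^{1/2}/(1-rz) · b_r(z)^{k-1}`
of the model space `K_{b_r^n}`. -/
def mw (r : ℝ) (k : ℕ) : ℂ → ℂ :=
  fun z => (Real.sqrt (1 - r ^ 2) : ℂ) / (1 - (r : ℂ) * z) * (blaschke (r : ℂ) z) ^ (k - 1)

lemma HasSum.of_eq {E : Type*} [AddCommMonoid E] [TopologicalSpace E] {f g : ℕ → E} {s t : E}
    (h : HasSum f s) (hfg : ∀ k, g k = f k) (hst : t = s) : HasSum g t := by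
  rw [hst, funext hfg]
  exact h

/-- The Taylor coefficients at `0` of the sum of a power series are its coefficients. -/
lemma hcoeff_eq_of_hasSum {f : ℂ → ℂ} {a : ℕ → ℂ}
    (h : ∀ z ∈ ball (0 : ℂ) 1, HasSum (fun k => a k * z ^ k) (f z)) (k : ℕ) :
    hcoeff f k = a k := by
  have hp : HasFPowerSeriesAt f (FormalMultilinearSeries.ofScalars ℂ a) 0 := by
    rw [hasFPowerSeriesAt_iff]
    filter_upwards [ball_mem_nhds (0 : ℂ) one_pos] with z hz
    simpa [FormalMultilinearSeries.coeff_ofScalars, mul_comm] using h z hz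
  have hq := hp.analyticAt.hasFPowerSeriesAt
  have := congrArg (fun p => FormalMultilinearSeries.coeff p k)
    (hq.eq_formalMultilinearSeries hp)
  simpa [FormalMultilinearSeries.coeff_ofScalars, hcoeff] using this

lemma hasSum_hcoeff {f : ℂ → ℂ} {R : ℝ} (hf : DifferentiableOn ℂ f (ball 0 R)) {z : ℂ}
    (hz : z ∈ ball (0 : ℂ) R) : HasSum (fun k => hcoeff f k * z ^ k) (f z) := by
  have hR : 0 < R := pos_of_mem_ball hz
  lift R to NNReal using hR.le
  have := Complex.hasSum_taylorSeries_on_ball hf hz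
  refine this.congr_fun ?_
  intro k
  simp [hcoeff]
  ring

lemma h2norm_congr {f g : ℂ → ℂ} (h : Set.EqOn f g (ball 0 1)) : h2norm f = h2norm g := by
  have he : f =ᶠ[nhds 0] g := h.eventuallyEq_of_mem (ball_mem_nhds 0 one_pos)
  simp only [h2norm, hcoeff, fun k => he.iteratedDeriv_eq k]

/-- A function holomorphic on a disc of radius larger than `1` belongs to `H²`. -/
lemma DifferentiableOn.memH2 {f : ℂ → ℂ} {R : ℝ} (hR : 1 < R)
    (hf : DifferentiableOn ℂ f (ball 0 R)) : MemH2 f := by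
  refine ⟨hf.mono (ball_subset_ball hR.le), ?_⟩
  have h := (hasSum_hcoeff hf (z := 1) (by simpa using hR)).summable
  simp only [one_pow, mul_one] at h
  refine Summable.of_norm_bounded_eventually_nat h.norm ?_
  filter_upwards [h.norm.tendsto_atTop_zero.eventually_le_const one_pos] with k hk
  rw [Real.norm_of_nonneg (by positivity)]
  nlinarith [norm_nonneg (hcoeff f k)]

lemma hcoeff_linear_mul_zero (α β : ℂ) (f : ℂ → ℂ) :
    hcoeff (fun z => (α + β * z) * f z) 0 = α * hcoeff f 0 := by
  simp [hcoeff]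

lemma hcoeff_linear_mul_succ (α β : ℂ) {f : ℂ → ℂ} (hf : DifferentiableOn ℂ f (ball 0 1))
    (k : ℕ) : hcoeff (fun z => (α + β * z) * f z) (k + 1) =
      α * hcoeff f (k + 1) + β * hcoeff f k := by
  have key := hcoeff_eq_of_hasSum (f := fun z => (α + β * z) * f z)
    (a := fun k => α * hcoeff f k + β * (if k = 0 then 0 else hcoeff f (k - 1))) (fun z hz => by
      have h := hasSum_hcoeff hf hz
      have h' : HasSum (fun k => (if k = 0 then 0 else hcoeff f (k - 1)) * z ^ k)
          (z * f z) := by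
        rw [hasSum_nat_add_iff' 1 |>.symm]
        simpa [pow_succ, mul_comm, mul_left_comm] using h.mul_left z
      exact ((h.mul_left α).add (h'.mul_left β)).of_eq (fun k => by ring) (by ring)) (k + 1)
  simpa using key

/-- `r - z` and `1 - rz` have the same modulus on the circle, hence are interchangeable as
multipliers in the `H²` norm. -/
lemma h2norm_sub_mul (r : ℝ) {f : ℂ → ℂ} (hf : MemH2 f) :
    h2norm (fun z => (r - z) * f z) = h2norm (fun z => (1 - r * z) * f z) := by
  have e₁ : (fun z => ((r : ℂ) - z) * f z) = fun z => (r + (-1) * z) * f z := by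
    ext z; ring
  have e₂ : (fun z => (1 - (r : ℂ) * z) * f z) = fun z => (1 + (-r) * z) * f z := by
    ext z; ring
  rw [e₁, e₂]
  have hu0 := hcoeff_linear_mul_zero r (-1) f
  have hv0 := hcoeff_linear_mul_zero 1 (-r) f
  have hu := hcoeff_linear_mul_succ r (-1) hf.1
  have hv := hcoeff_linear_mul_succ 1 (-r) hf.1
  have hs := hf.2
  unfold h2norm
  generalize hcoeff (fun z => ((r : ℂ) + (-1) * z) * f z) = u at *
  generalize hcoeff (fun z => (1 + (-r : ℂ) * z) * f z) = v at *
  generalize hcoeff f = a at *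
  have hs' : Summable fun k => ‖a (k + 1)‖ ^ 2 :=
    (summable_nat_add_iff (f := fun k => ‖a k‖ ^ 2) 1).2 hs
  have hd (k : ℕ) : ‖u (k + 1)‖ ^ 2 = ‖v (k + 1)‖ ^ 2 +
      (r ^ 2 - 1) * (‖a (k + 1)‖ ^ 2 - ‖a k‖ ^ 2) := by
    rw [hu, hv]
    simp only [← Complex.normSq_eq_norm_sq, Complex.normSq_apply]
    simp
    ring
  have hv' : Summable fun k => ‖v (k + 1)‖ ^ 2 := by
    refine Summable.of_nonneg_of_le (fun k => by positivity) (fun k => ?_)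
      ((hs'.add (hs.mul_left (r ^ 2))).mul_left 2)
    rw [hv]
    have := norm_add_le (1 * a (k + 1)) (-r * a k)
    simp only [one_mul, neg_mul, norm_neg, norm_mul, Complex.norm_real] at this ⊢
    have h2 := pow_le_pow_left₀ (norm_nonneg _) this 2
    have h3 : (‖r‖ * ‖a k‖) ^ 2 = r ^ 2 * ‖a k‖ ^ 2 := by
      rw [mul_pow, Real.norm_eq_abs, sq_abs]
    nlinarith [sq_nonneg (‖a (k + 1)‖ - ‖r‖ * ‖a k‖)]
  have hu' : Summable fun k => ‖u (k + 1)‖ ^ 2 := by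
    simp only [hd]
    exact hv'.add ((hs'.sub hs).mul_left _)
  congr 1
  rw [((summable_nat_add_iff (f := fun k => ‖u k‖ ^ 2) 1).1 hu').tsum_eq_zero_add,
    ((summable_nat_add_iff (f := fun k => ‖v k‖ ^ 2) 1).1 hv').tsum_eq_zero_add]
  simp only [hd]
  rw [hv'.tsum_add ((hs'.sub hs).mul_left _), tsum_mul_left, hs'.tsum_sub hs,
    hs.tsum_eq_zero_add, hu0, hv0]
  simp only [norm_mul, mul_pow, Complex.norm_real, Real.norm_eq_abs, sq_abs, norm_one]
  ring

lemma h2norm_sub_pow_mul (r : ℝ) {R : ℝ} (hR : 1 < R) (m : ℕ) {f : ℂ → ℂ}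
    (hf : DifferentiableOn ℂ f (ball 0 R)) :
    h2norm (fun z => (r - z) ^ m * f z) = h2norm (fun z => (1 - r * z) ^ m * f z) := by
  induction m generalizing f with
  | zero => simp
  | succ m ih =>
    have h₁ := ih (f := fun z => (r - z) * f z) (by fun_prop)
    have h₂ := h2norm_sub_mul r (f := fun z => (1 - r * z) ^ m * f z)
      (DifferentiableOn.memH2 hR (by fun_prop))
    simp only [pow_succ, mul_assoc]
    refine h₁.trans (Eq.trans ?_ (h₂.trans ?_)) <;> congr 1 <;> ext z <;> ring

lemma h2norm_const_mul (c : ℂ) {f : ℂ → ℂ} (hf : DifferentiableOn ℂ f (ball 0 1)) :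
    h2norm (fun z => c * f z) = ‖c‖ * h2norm f := by
  have h (k : ℕ) : hcoeff (fun z => c * f z) k = c * hcoeff f k :=
    hcoeff_eq_of_hasSum (a := fun k => c * hcoeff f k) (fun z hz => by
      simpa [mul_assoc] using (hasSum_hcoeff hf hz).mul_left c) k
  simp only [h2norm, h, norm_mul, mul_pow, tsum_mul_left]
  rw [Real.sqrt_mul (by positivity), Real.sqrt_sq (norm_nonneg c)]

lemma cast_add_choose_eq_ascFactorial_div {K : Type*} [Field K] [CharZero K] (j k : ℕ) :
    (((k + j).choose j : ℕ) : K) = ((k + 1).ascFactorial j : K) / j.factorial := by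
  have : (j.factorial : K) ≠ 0 := by exact_mod_cast j.factorial_ne_zero
  rw [Nat.ascFactorial_eq_factorial_mul_choose]
  field_simp
  push_cast
  ring

lemma hasSum_sq_mul_geometric {x : ℝ} (hx0 : 0 ≤ x) (hx1 : x < 1) (n : ℝ) :
    HasSum (fun k : ℕ => ((k + 1) - n * (1 - x) * ((k + 1) * (k + 2) / 2)) ^ 2 * x ^ k)
      (((n - 1) ^ 2 + (2 * n - 1) ^ 2 * x + n ^ 2 * x ^ 2) / (1 - x) ^ 3) := by
  have hx : ‖x‖ < 1 := by rwa [Real.norm_of_nonneg hx0]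
  have S (j : ℕ) := hasSum_choose_mul_geometric_of_norm_lt_one j hx
  have h1x : 1 - x ≠ 0 := by linarith
  set c := n * (1 - x) / 2 with hc
  refine HasSum.of_eq ((((S 4).mul_left (24 * c ^ 2)).add
    ((S 3).mul_left (-24 * c ^ 2 - 12 * c))).add
    (((S 2).mul_left (4 * c ^ 2 + 8 * c + 2)).add ((S 1).mul_left (-1)))) (fun k => ?_) ?_
  · simp only [cast_add_choose_eq_ascFactorial_div, hc]
    simp only [Nat.ascFactorial, Nat.factorial]
    push_cast
    ring
  · rw [hc]
    field_simp
    ring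

lemma one_sub_mul_ne_zero {r R : ℝ} (hr0 : 0 ≤ r) (hR : r * R < 1) {z : ℂ}
    (hz : z ∈ ball (0 : ℂ) R) : 1 - (r : ℂ) * z ≠ 0 := by
  intro h
  have h1 : ‖(r : ℂ) * z‖ = 1 := by rw [← sub_eq_zero.1 h, norm_one]
  rw [norm_mul, Complex.norm_real, Real.norm_of_nonneg hr0] at h1
  have := mul_le_mul_of_nonneg_left (mem_ball_zero_iff.1 hz).le hr0
  linarith

lemma deriv_mw {r : ℝ} (m : ℕ) {z : ℂ} (hz : 1 - (r : ℂ) * z ≠ 0) :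
    deriv (mw r (m + 2)) z = (Real.sqrt (1 - r ^ 2) : ℂ) * ((r - z) ^ m *
      (((1 - r * z) - (m + 2) * (1 - r ^ 2)) / (1 - r * z) ^ (m + 3))) := by
  have hd : HasDerivAt (fun w : ℂ => 1 - (r : ℂ) * w) (-r) z := by
    simpa using ((hasDerivAt_id z).const_mul (r : ℂ)).const_sub 1
  have hn : HasDerivAt (fun w : ℂ => (r : ℂ) - w) (-1) z := (hasDerivAt_id z).const_sub _
  have h := ((hasDerivAt_const z (Real.sqrt (1 - r ^ 2) : ℂ)).div hd hz).mul
    ((hn.div hd hz).pow (m + 1))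
  have he : mw r (m + 2) = ((fun _ => (Real.sqrt (1 - r ^ 2) : ℂ)) /
      fun w : ℂ => 1 - (r : ℂ) * w) *
      ((fun w : ℂ => (r : ℂ) - w) / fun w : ℂ => 1 - (r : ℂ) * w) ^ (m + 1) := by
    ext w
    simp [mw, blaschke]
  rw [he, h.deriv]
  simp only [Pi.pow_apply, Pi.div_apply, div_pow, add_tsub_cancel_right]
  push_cast
  field_simp
  ring

lemma h2norm_rational {r : ℝ} (hr0 : 0 ≤ r) (hr1 : r < 1) (n : ℝ) :
    h2norm (fun z => ((1 - r * z) - n * (1 - r ^ 2)) / (1 - r * z) ^ 3) ^ 2 =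
      ((n - 1) ^ 2 + (2 * n - 1) ^ 2 * r ^ 2 + n ^ 2 * r ^ 4) / (1 - r ^ 2) ^ 3 := by
  have hc := hcoeff_eq_of_hasSum
    (f := fun z => ((1 - r * z) - n * (1 - r ^ 2)) / (1 - r * z) ^ 3)
    (a := fun k : ℕ =>
      (((((k : ℝ) + 1) - n * (1 - r ^ 2) * ((k + 1) * (k + 2) / 2)) * r ^ k : ℝ) : ℂ))
    (fun z hz => by
      have h0 := one_sub_mul_ne_zero hr0 (by simpa using hr1) hz
      have hx : ‖(r : ℂ) * z‖ < 1 := by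
        rw [norm_mul, Complex.norm_real, Real.norm_of_nonneg hr0]
        have := mem_ball_zero_iff.1 hz
        nlinarith [norm_nonneg z]
      refine HasSum.of_eq ((hasSum_choose_mul_geometric_of_norm_lt_one 1 hx).add
        ((hasSum_choose_mul_geometric_of_norm_lt_one 2 hx).mul_left
          (-(n : ℂ) * (1 - r ^ 2)))) (fun k => ?_) ?_
      · simp only [cast_add_choose_eq_ascFactorial_div]
        simp only [Nat.ascFactorial, Nat.factorial]
        push_cast
        ring
      · field_simp
        ring)
  have hx1 : r ^ 2 < 1 := by nlinarith
  rw [h2norm, Real.sq_sqrt (tsum_nonneg fun k => by positivity)]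
  convert (hasSum_sq_mul_geometric (sq_nonneg r) hx1 n).tsum_eq using 1
  · congr 1
    ext k
    rw [hc, Complex.norm_real, Real.norm_eq_abs, sq_abs]
    ring
  · ring

lemma h2norm_quadratic_sq (a b c : ℝ) :
    h2norm (fun z => a + b * z + c * z ^ 2) ^ 2 = a ^ 2 + b ^ 2 + c ^ 2 := by
  have hc := hcoeff_eq_of_hasSum (f := fun z => (a : ℂ) + b * z + c * z ^ 2)
    (a := fun k => if k = 0 then (a : ℂ) else if k = 1 then (b : ℂ)
      else if k = 2 then (c : ℂ) else 0)
    (fun z _ => by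
      refine HasSum.of_eq (hasSum_sum_of_ne_finset_zero (s := Finset.range 3) ?_)
        (fun k => rfl) ?_
      rotate_left
      · simp [Finset.sum_range_succ]
      · intro k hk
        simp only [Finset.mem_range] at hk
        rw [if_neg (by omega), if_neg (by omega), if_neg (by omega), zero_mul])
  rw [h2norm, Real.sq_sqrt (tsum_nonneg fun k => by positivity)]
  simp only [hc]
  rw [tsum_eq_sum (s := Finset.range 3)]
  · simp [Finset.sum_range_succ]
  · intro k hk
    simp only [Finset.mem_range] at hk
    rw [if_neg (by omega), if_neg (by omega), if_neg (by omega)]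
    simp

/-- For `n ≥ 2`, `0 ≤ r < 1` and the Malmquist–Walsh function
`e_n(z) = (1-r²)^{1/2}/(1-rz)·b_r(z)^{n-1}`, one has
`‖e_n'‖₂ = (1/(1-r²))·‖φ_n‖₂` where `φ_n(z) = (1+rz)(nrz + (n-1))`, and
`‖φ_n‖₂² = (n-1)² + (2n-1)²r² + n²r⁴`. -/
theorem stmt12 (n : ℕ) (hn : 2 ≤ n) (r : ℝ) (hr0 : 0 ≤ r) (hr1 : r < 1)
    (phi : ℂ → ℂ)
    (hphi : phi = fun z => (1 + (r : ℂ) * z) * ((n : ℂ) * (r : ℂ) * z + ((n : ℂ) - 1))) :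
    h2norm (deriv (mw r n)) = (1 / (1 - r ^ 2)) * h2norm phi ∧
    h2norm phi ^ 2 =
      ((n : ℝ) - 1) ^ 2 + (2 * (n : ℝ) - 1) ^ 2 * r ^ 2 + (n : ℝ) ^ 2 * r ^ 4 := by
  have hphi2 : h2norm phi ^ 2 =
      ((n : ℝ) - 1) ^ 2 + (2 * (n : ℝ) - 1) ^ 2 * r ^ 2 + (n : ℝ) ^ 2 * r ^ 4 := by
    have h := h2norm_quadratic_sq ((n : ℝ) - 1) ((2 * n - 1) * r) (n * r ^ 2)
    rw [hphi]
    convert h using 1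
    · congr 2
      ext z
      push_cast
      ring
    · ring
  refine ⟨?_, hphi2⟩
  obtain ⟨m, rfl⟩ := Nat.exists_eq_add_of_le' hn
  have hx1 : 0 < 1 - r ^ 2 := by nlinarith
  have hR : 1 < 2 / (1 + r) := by rw [lt_div_iff₀ (by linarith)]; linarith
  have hrR : r * (2 / (1 + r)) < 1 := by
    rw [mul_div_assoc', div_lt_one (by linarith)]; linarith
  have hne (z : ℂ) (hz : z ∈ ball (0 : ℂ) (2 / (1 + r))) := one_sub_mul_ne_zero hr0 hrR hz
  have hd (j : ℕ) : DifferentiableOn ℂ (fun z : ℂ =>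
      ((1 - r * z) - (m + 2) * (1 - r ^ 2)) / (1 - r * z) ^ j) (ball 0 (2 / (1 + r))) :=
    DifferentiableOn.div (by fun_prop) (by fun_prop) fun z hz => pow_ne_zero _ (hne z hz)
  have hF : h2norm (deriv (mw r (m + 2))) = Real.sqrt (1 - r ^ 2) *
      h2norm (fun z => ((1 - r * z) - ((m + 2 : ℕ) : ℝ) * (1 - r ^ 2)) / (1 - r * z) ^ 3) := by
    rw [h2norm_congr fun z hz => deriv_mw m (hne z (ball_subset_ball hR.le hz)),
      h2norm_const_mul _ (f := fun z => (r - z) ^ m *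
        (((1 - r * z) - (m + 2) * (1 - r ^ 2)) / (1 - r * z) ^ (m + 3)))
        (DifferentiableOn.mul (by fun_prop) ((hd _).mono (ball_subset_ball hR.le))),
      h2norm_sub_pow_mul r hR m (hd _), Complex.norm_real,
      Real.norm_of_nonneg (Real.sqrt_nonneg _)]
    congr 1
    refine h2norm_congr fun z hz => ?_
    have := hne z (ball_subset_ball hR.le hz)
    push_cast
    field_simp
    ring
  have hnn (f : ℂ → ℂ) : 0 ≤ h2norm f := Real.sqrt_nonneg _
  rw [← sq_eq_sq₀ (hnn _) (mul_nonneg (by positivity) (hnn _)), mul_pow, hphi2, hF, mul_pow,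
    Real.sq_sqrt hx1.le, h2norm_rational hr0 hr1]
  field_simp
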